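/- arXiv:1708.02641 — 2 statements merged into one kernel-verified Lean document; each statement's English description precedes it below -/
import Mathlib

section
/- Let C and B be weakly dual Hopf algebras over a field k with pairing ev, and let A be a left B-comodule algebra with coaction δ_A(a)=a⁽⁻¹⁾⊗a⁽⁰⁾. Define on the vector space A⊗C the product (a⊗c)(a'⊗c') := a a'⁽⁰⁾ ⊗ c₍₁₎c' · ev(c₍₂₎, a'⁽⁻¹⁾) with unit 1⊗1 (the crossed product A⋊C^cop), and define δ: A⊗C → (B⊗C)⊗(A⊗C) by δ(a⊗c) := (a⁽⁻¹⁾⊗c₍₂₎) ⊗ (a⁽⁰⁾⊗c₍₁₎). Then: (i) A⋊C^cop is an associative unital k-algebra; (ii) δ is a left Drin_k(C,B)-comodule structure, i.e. (Δ_Drin⊗id)∘δ = (id⊗δ)∘δ and (ε_Drin⊗id)∘δ = id; (iii) δ is an algebra homomorphism from A⋊C^cop to Drin_k(C,B)⊗(A⋊C^cop) (componentwise product, with the Drinfeld double product in the first factor) and δ(1⊗1)=(1⊗1)⊗(1⊗1). Hence A⋊C^cop is a left Drin_k(C,B)-comodule algebra. -/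
/-!
STATEMENT 17: For weakly dual Hopf algebras `C`, `B` and a left `B`-comodule algebra `A`,
the crossed product `A ⋊ C^cop` (on the vector space `A ⊗ C`, with product
`(a⊗c)(a'⊗c') = a a'⁽⁰⁾ ⊗ c₍₁₎c' · ev(c₍₂₎, a'⁽⁻¹⁾)`) together with
`δ(a⊗c) = (a⁽⁻¹⁾⊗c₍₂₎) ⊗ (a⁽⁰⁾⊗c₍₁₎)` is a left `Drin_k(C,B)`-comodule algebra.
-/

open scoped TensorProduct

noncomputable section

variable {k B C : Type} [Field k] [Ring B] [HopfAlgebra k B] [Ring C] [HopfAlgebra k C]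

/-- `ev : C × B → k` is a weak Hopf algebra pairing. -/
def IsWeakHopfPairing (ev : C →ₗ[k] B →ₗ[k] k) : Prop :=
  (∀ (c c' : C) (b : B) (n : ℕ) (b1 b2 : Fin n → B),
    Coalgebra.comul (R := k) b = ∑ i, b1 i ⊗ₜ[k] b2 i →
    ev (c * c') b = ∑ i, ev c (b2 i) * ev c' (b1 i)) ∧
  (∀ (c : C) (b b' : B) (m : ℕ) (c1 c2 : Fin m → C),
    Coalgebra.comul (R := k) c = ∑ j, c1 j ⊗ₜ[k] c2 j →
    ev c (b * b') = ∑ j, ev (c1 j) b' * ev (c2 j) b) ∧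
  (∀ b : B, ev 1 b = Coalgebra.counit (R := k) b) ∧
  (∀ c : C, ev c 1 = Coalgebra.counit (R := k) c) ∧
  (∀ (c : C) (b : B),
    ev (HopfAlgebra.antipode (R := k) c) b = ev c (HopfAlgebra.antipode (R := k) b))

/-- The coproduct of the Drinfeld double: `Δ(b⊗c) = (b₍₁₎⊗c₍₂₎) ⊗ (b₍₂₎⊗c₍₁₎)`. -/
def DrinComul (k B C : Type) [Field k] [Ring B] [HopfAlgebra k B] [Ring C]
    [HopfAlgebra k C] : B ⊗[k] C →ₗ[k] (B ⊗[k] C) ⊗[k] (B ⊗[k] C) :=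
  (TensorProduct.tensorTensorTensorComm k B B C C).toLinearMap
    ∘ₗ TensorProduct.map (Coalgebra.comul (R := k))
        ((TensorProduct.comm k C C).toLinearMap ∘ₗ Coalgebra.comul (R := k))

/-- The counit of the Drinfeld double: `ε(b⊗c) = ε(b)ε(c)`. -/
def DrinCounit (k B C : Type) [Field k] [Ring B] [HopfAlgebra k B] [Ring C]
    [HopfAlgebra k C] : B ⊗[k] C →ₗ[k] k :=
  LinearMap.mul' k k ∘ₗ TensorProduct.map (Coalgebra.counit (R := k)) (Coalgebra.counit (R := k))

/-- `mD` is the product of the Drinfeld double `Drin_k(C,B)`: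
`(b⊗c)(b'⊗c') = b b'₍₂₎ ⊗ c₍₂₎c' · ev(c₍₁₎, S(b'₍₃₎)) · ev(c₍₃₎, b'₍₁₎)`. -/
def IsDrinMul (ev : C →ₗ[k] B →ₗ[k] k)
    (mD : (B ⊗[k] C) ⊗[k] (B ⊗[k] C) →ₗ[k] B ⊗[k] C) : Prop :=
  ∀ (b : B) (c : C) (b' : B) (c' : C)
    (n : ℕ) (p1 p2 : Fin n → B) (q : Fin n → ℕ) (pp1 pp2 : (i : Fin n) → Fin (q i) → B)
    (m : ℕ) (r1 r2 : Fin m → C) (s : Fin m → ℕ) (rr1 rr2 : (j : Fin m) → Fin (s j) → C),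
    Coalgebra.comul (R := k) b' = ∑ i, p1 i ⊗ₜ[k] p2 i →
    (∀ i, Coalgebra.comul (R := k) (p2 i) = ∑ i', pp1 i i' ⊗ₜ[k] pp2 i i') →
    Coalgebra.comul (R := k) c = ∑ j, r1 j ⊗ₜ[k] r2 j →
    (∀ j, Coalgebra.comul (R := k) (r2 j) = ∑ j', rr1 j j' ⊗ₜ[k] rr2 j j') →
    mD ((b ⊗ₜ[k] c) ⊗ₜ[k] (b' ⊗ₜ[k] c'))
      = ∑ i, ∑ i', ∑ j, ∑ j',
          (ev (r1 j) (HopfAlgebra.antipode (R := k) (pp2 i i')) * ev (rr2 j j') (p1 i))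
            • ((b * pp1 i i') ⊗ₜ[k] (rr1 j j' * c'))

/-- The `Drin_k(C,B)`-coaction `δ(a⊗c) = (a⁽⁻¹⁾⊗c₍₂₎) ⊗ (a⁽⁰⁾⊗c₍₁₎)` on `A ⋊ C^cop`. -/
def crossedCoaction {A : Type} [Ring A] [Algebra k A] (δA : A →ₗ[k] B ⊗[k] A) :
    A ⊗[k] C →ₗ[k] (B ⊗[k] C) ⊗[k] (A ⊗[k] C) :=
  (TensorProduct.tensorTensorTensorComm k B A C C).toLinearMap
    ∘ₗ TensorProduct.map δA ((TensorProduct.comm k C C).toLinearMap ∘ₗ Coalgebra.comul (R := k))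

namespace CrossedAux

open Coalgebra TensorProduct

theorem exists_rep {M N : Type} [AddCommGroup M] [AddCommGroup N] [Module k M] [Module k N]
    (t : M ⊗[k] N) : ∃ (n : ℕ) (f : Fin n → M) (g : Fin n → N), t = ∑ i, f i ⊗ₜ[k] g i := by
  obtain ⟨n, f, g, h⟩ := TensorProduct.exists_sum_tmul_eq t
  exact ⟨n, f, g, h⟩

/-- `R b c = c₍₁₎ ev(c₍₂₎, b)` -/
def Ra (ev : C →ₗ[k] B →ₗ[k] k) : B →ₗ[k] C →ₗ[k] C :=
  LinearMap.mk₂ k (fun b c => TensorProduct.rid k C ((ev.flip b).lTensor C (comul (R := k) c)))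
    (by intros; simp [LinearMap.lTensor_add]) (by intros; simp [LinearMap.lTensor_smul])
    (by intros; simp) (by intros; simp)

/-- `L b c = ev(c₍₁₎, b) c₍₂₎` -/
def La (ev : C →ₗ[k] B →ₗ[k] k) : B →ₗ[k] C →ₗ[k] C :=
  LinearMap.mk₂ k (fun b c => TensorProduct.lid k C ((ev.flip b).rTensor C (comul (R := k) c)))
    (by intros; simp [LinearMap.rTensor_add]) (by intros; simp [LinearMap.rTensor_smul])
    (by intros; simp) (by intros; simp)

theorem Ra_apply (ev : C →ₗ[k] B →ₗ[k] k) (b : B) (c : C) :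
    Ra ev b c = TensorProduct.rid k C ((ev.flip b).lTensor C (comul (R := k) c)) := rfl

theorem La_apply (ev : C →ₗ[k] B →ₗ[k] k) (b : B) (c : C) :
    La ev b c = TensorProduct.lid k C ((ev.flip b).rTensor C (comul (R := k) c)) := rfl

theorem Ra_sum (ev : C →ₗ[k] B →ₗ[k] k) (b : B) (c : C) {m : ℕ} (r1 r2 : Fin m → C)
    (h : comul (R := k) c = ∑ j, r1 j ⊗ₜ[k] r2 j) :
    Ra ev b c = ∑ j, ev (r2 j) b • r1 j := by
  rw [Ra_apply, h]; simp

theorem La_sum (ev : C →ₗ[k] B →ₗ[k] k) (b : B) (c : C) {m : ℕ} (r1 r2 : Fin m → C)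
    (h : comul (R := k) c = ∑ j, r1 j ⊗ₜ[k] r2 j) :
    La ev b c = ∑ j, ev (r1 j) b • r2 j := by
  rw [La_apply, h]; simp

theorem comul_Ra (ev : C →ₗ[k] B →ₗ[k] k) (b : B) (c : C) :
    comul (R := k) (Ra ev b c) = (Ra ev b).lTensor C (comul c) := by
  have h1 : ∀ t : C ⊗[k] C, comul (R := k) (TensorProduct.rid k C ((ev.flip b).lTensor C t))
      = ((TensorProduct.rid k C).toLinearMap ∘ₗ (ev.flip b).lTensor C).lTensor C
        (TensorProduct.assoc k C C C ((comul (R := k)).rTensor C t)) := by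
    intro t
    induction t with
    | zero => simp
    | add x y hx hy => simp only [map_add, hx, hy]
    | tmul p q =>
      simp only [LinearMap.lTensor_tmul, LinearMap.rTensor_tmul, TensorProduct.rid_tmul, map_smul]
      generalize comul (R := k) p = s
      induction s with
      | zero => simp
      | add x y hx hy => simp only [smul_add, TensorProduct.add_tmul, map_add, hx, hy]
      | tmul p' q' => simp
  rw [Ra_apply, h1, coassoc_apply, ← LinearMap.comp_apply, ← LinearMap.lTensor_comp]
  rfl

theorem comul_La (ev : C →ₗ[k] B →ₗ[k] k) (b : B) (c : C) :
    comul (R := k) (La ev b c) = (La ev b).rTensor C (comul c) := by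
  have h1 : ∀ t : C ⊗[k] C, comul (R := k) (TensorProduct.lid k C ((ev.flip b).rTensor C t))
      = ((TensorProduct.lid k C).toLinearMap ∘ₗ (ev.flip b).rTensor C).rTensor C
        ((TensorProduct.assoc k C C C).symm ((comul (R := k)).lTensor C t)) := by
    intro t
    induction t with
    | zero => simp
    | add x y hx hy => simp only [map_add, hx, hy]
    | tmul p q =>
      simp only [LinearMap.lTensor_tmul, LinearMap.rTensor_tmul, TensorProduct.lid_tmul, map_smul]
      generalize comul (R := k) q = s
      induction s with
      | zero => simp
      | add x y hx hy => simp only [smul_add, TensorProduct.tmul_add, map_add, hx, hy]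
      | tmul p' q' => simp [TensorProduct.smul_tmul']
  rw [La_apply, h1, coassoc_symm_apply, ← LinearMap.comp_apply, ← LinearMap.rTensor_comp]
  rfl

theorem balance (ev : C →ₗ[k] B →ₗ[k] k) (b : B) (c : C) :
    (Ra ev b).rTensor C (comul (R := k) c) = (La ev b).lTensor C (comul c) := by
  have h1 : ∀ t : C ⊗[k] C, (Ra ev b).rTensor C t
      = ((TensorProduct.lid k C).toLinearMap ∘ₗ (ev.flip b).rTensor C).lTensor C
        (TensorProduct.assoc k C C C ((comul (R := k)).rTensor C t)) := by
    intro t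
    induction t with
    | zero => simp
    | add x y hx hy => simp only [map_add, hx, hy]
    | tmul p q =>
      simp only [LinearMap.rTensor_tmul, Ra_apply]
      generalize comul (R := k) p = s
      induction s with
      | zero => simp
      | add x y hx hy => simp only [TensorProduct.add_tmul, map_add, hx, hy]
      | tmul p' q' => simp [TensorProduct.smul_tmul]
  rw [h1, coassoc_apply, ← LinearMap.comp_apply, ← LinearMap.lTensor_comp]
  rfl

theorem Ra_La (ev : C →ₗ[k] B →ₗ[k] k) (b b' : B) (c : C) :
    Ra ev b (La ev b' c) = La ev b' (Ra ev b c) := by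
  rw [Ra_apply, comul_La, Ra_apply]
  generalize comul (R := k) c = s
  induction s with
  | zero => simp
  | add x y hx hy => simp only [map_add, hx, hy]
  | tmul p' q' => simp

section pairing

variable {ev : C →ₗ[k] B →ₗ[k] k}

theorem ev_Ra (hev : IsWeakHopfPairing ev) (b b' : B) (c : C) : ev (Ra ev b c) b' = ev c (b * b') := by
  obtain ⟨n, f, g, h⟩ := exists_rep (comul (R := k) c)
  rw [hev.2.1 c b b' n f g h, Ra_sum ev b c f g h]
  simp [mul_comm]

theorem ev_La (hev : IsWeakHopfPairing ev) (b b' : B) (c : C) : ev (La ev b' c) b = ev c (b * b') := by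
  obtain ⟨n, f, g, h⟩ := exists_rep (comul (R := k) c)
  rw [hev.2.1 c b b' n f g h, La_sum ev b' c f g h]
  simp

theorem Ra_mul (hev : IsWeakHopfPairing ev) (b b' : B) (c : C) : Ra ev (b * b') c = Ra ev b' (Ra ev b c) := by
  rw [Ra_apply, Ra_apply, comul_Ra, ← LinearMap.lTensor_comp_apply]
  congr 3
  ext c
  simp [ev_Ra hev]

theorem La_mul (hev : IsWeakHopfPairing ev) (b b' : B) (c : C) : La ev (b * b') c = La ev b (La ev b' c) := by
  rw [La_apply, La_apply, comul_La, ← LinearMap.rTensor_comp_apply]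
  congr 3
  ext c
  simp [ev_La hev]

theorem Ra_one (hev : IsWeakHopfPairing ev) (c : C) : Ra ev 1 c = c := by
  have : ev.flip 1 = counit (R := k) := by ext c; simp [hev.2.2.2.1]
  rw [Ra_apply, this]; simp

theorem La_one (hev : IsWeakHopfPairing ev) (c : C) : La ev 1 c = c := by
  have : ev.flip 1 = counit (R := k) := by ext c; simp [hev.2.2.2.1]
  rw [La_apply, this]; simp

theorem Ra_one' (hev : IsWeakHopfPairing ev) (b : B) : Ra ev b 1 = counit (R := k) b • 1 := by
  rw [Ra_apply]; simp [Algebra.TensorProduct.one_def, hev.2.2.1]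

theorem Ra_mul' (hev : IsWeakHopfPairing ev) (b : B) (c c' : C) {n : ℕ} (b1 b2 : Fin n → B)
    (h : comul (R := k) b = ∑ i, b1 i ⊗ₜ[k] b2 i) :
    Ra ev b (c * c') = ∑ i, Ra ev (b2 i) c * Ra ev (b1 i) c' := by
  rw [Ra_apply, Bialgebra.comul_mul]
  simp only [Ra_apply]
  generalize comul (R := k) c = s
  generalize comul (R := k) c' = s'
  induction s with
  | zero => simp
  | add x y hx hy => simp only [map_add, add_mul, hx, hy, Finset.sum_add_distrib]
  | tmul p q =>
    induction s' with
    | zero => simp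
    | add x y hx hy => simp only [map_add, mul_add, hx, hy, Finset.sum_add_distrib]
    | tmul p' q' =>
      simp [hev.1 q q' b n b1 b2 h, Finset.sum_smul, smul_smul, mul_comm]

end pairing

section algebra

variable {A : Type} [Ring A] [Algebra k A]

/-- The crossed product as a function of the coaction of the second factor. -/
def mu (ev : C →ₗ[k] B →ₗ[k] k) (a : A) (c c' : C) : B ⊗[k] A →ₗ[k] A ⊗[k] C :=
  TensorProduct.map (LinearMap.mulLeft k a) (LinearMap.mulRight k c' ∘ₗ (Ra ev).flip c)
    ∘ₗ (TensorProduct.comm k B A).toLinearMap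

@[simp] theorem mu_tmul (ev : C →ₗ[k] B →ₗ[k] k) (a : A) (c c' : C) (b : B) (x : A) :
    mu ev a c c' (b ⊗ₜ[k] x) = (a * x) ⊗ₜ[k] (Ra ev b c * c') := by
  simp [mu]

/-- The triple crossed product as a function of the iterated coaction. -/
def nu (ev : C →ₗ[k] B →ₗ[k] k) (a : A) (d c' c'' : C) :
    B ⊗[k] (B ⊗[k] A) →ₗ[k] A ⊗[k] C :=
  TensorProduct.map (LinearMap.mulLeft k a)
      (LinearMap.mulRight k c'' ∘ₗ LinearMap.mul' k C ∘ₗ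
        TensorProduct.map ((Ra ev).flip d) ((Ra ev).flip c'))
    ∘ₗ (TensorProduct.assoc k A B B).toLinearMap
    ∘ₗ (TensorProduct.comm k B (A ⊗[k] B)).toLinearMap
    ∘ₗ (TensorProduct.comm k B A).toLinearMap.lTensor B

@[simp] theorem nu_tmul (ev : C →ₗ[k] B →ₗ[k] k) (a : A) (d c' c'' : C) (b b' : B) (x : A) :
    nu ev a d c' c'' (b ⊗ₜ[k] (b' ⊗ₜ[k] x))
      = (a * x) ⊗ₜ[k] (Ra ev b' d * Ra ev b c' * c'') := by
  simp [nu]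

theorem mu_mul {ev : C →ₗ[k] B →ₗ[k] k} (hev : IsWeakHopfPairing ev) (a : A) (d c' c'' : C)
    (t : B ⊗[k] A) :
    mu ev a (d * c') c'' t = nu ev a d c' c''
      (TensorProduct.assoc k B B A ((comul (R := k)).rTensor A t)) := by
  induction t with
  | zero => simp
  | add x y hx hy => simp only [map_add, hx, hy]
  | tmul b x =>
    obtain ⟨n, f, g, h⟩ := exists_rep (comul (R := k) b)
    simp [h, Ra_mul' hev b d c' f g h, TensorProduct.sum_tmul, TensorProduct.tmul_sum,
      Finset.sum_mul]

theorem mu_tmul_mul {ev : C →ₗ[k] B →ₗ[k] k} (hev : IsWeakHopfPairing ev) (a a0 : A)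
    (b x : B) (c c' c'' : C) (w : B ⊗[k] A) :
    mu ev a c (Ra ev x c' * c'') ((b ⊗ₜ[k] a0) * w)
      = nu ev (a * a0) (Ra ev b c) c' c'' (x ⊗ₜ[k] w) := by
  induction w with
  | zero => simp
  | add x y hx hy => simp only [map_add, mul_add, TensorProduct.tmul_add, hx, hy]
  | tmul u v => simp [Ra_mul hev, mul_assoc]

/-- regrouping map for the coassociativity of the crossed coaction -/
def kap (k B C A : Type) [Field k] [Ring B] [HopfAlgebra k B] [Ring C] [HopfAlgebra k C]
    [Ring A] [Algebra k A] : (B ⊗[k] (B ⊗[k] A)) ⊗[k] (C ⊗[k] (C ⊗[k] C)) →ₗ[k]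
      (B ⊗[k] C) ⊗[k] ((B ⊗[k] C) ⊗[k] (A ⊗[k] C)) :=
  (TensorProduct.tensorTensorTensorComm k B A C C).toLinearMap.lTensor (B ⊗[k] C)
    ∘ₗ (TensorProduct.tensorTensorTensorComm k B (B ⊗[k] A) C (C ⊗[k] C)).toLinearMap
    ∘ₗ ((TensorProduct.assoc k C C C).toLinearMap
        ∘ₗ (TensorProduct.comm k C (C ⊗[k] C)).toLinearMap
        ∘ₗ (TensorProduct.comm k C C).toLinearMap.lTensor C).lTensor (B ⊗[k] (B ⊗[k] A))

@[simp] theorem kap_tmul (x y : B) (a : A) (p q r : C) :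
    kap k B C A ((x ⊗ₜ[k] (y ⊗ₜ[k] a)) ⊗ₜ[k] (p ⊗ₜ[k] (q ⊗ₜ[k] r)))
      = (x ⊗ₜ[k] r) ⊗ₜ[k] ((y ⊗ₜ[k] q) ⊗ₜ[k] (a ⊗ₜ[k] p)) := by
  simp [kap]

theorem drin_kap (b : B) (a : A) (p q : C) :
    TensorProduct.assoc k (B ⊗[k] C) (B ⊗[k] C) (A ⊗[k] C)
      (DrinComul k B C (b ⊗ₜ[k] q) ⊗ₜ[k] (a ⊗ₜ[k] p))
    = kap k B C A ((TensorProduct.assoc k B B A (comul (R := k) b ⊗ₜ[k] a)) ⊗ₜ[k]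
        (p ⊗ₜ[k] comul (R := k) q)) := by
  obtain ⟨n, f, g, h⟩ := exists_rep (comul (R := k) b)
  obtain ⟨n', f', g', h'⟩ := exists_rep (comul (R := k) q)
  simp [DrinComul, h, h', TensorProduct.sum_tmul, TensorProduct.tmul_sum]

theorem crossed_kap (δA : A →ₗ[k] B ⊗[k] A) (b : B) (a : A) (p q : C) :
    (b ⊗ₜ[k] q) ⊗ₜ[k] crossedCoaction δA (a ⊗ₜ[k] p)
    = kap k B C A ((b ⊗ₜ[k] δA a) ⊗ₜ[k]
        (TensorProduct.assoc k C C C (comul (R := k) p ⊗ₜ[k] q))) := by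
  obtain ⟨n, f, g, h⟩ := exists_rep (δA a)
  obtain ⟨n', f', g', h'⟩ := exists_rep (comul (R := k) p)
  simp [crossedCoaction, h, h', TensorProduct.sum_tmul, TensorProduct.tmul_sum]

theorem crossed_sum (δA : A →ₗ[k] B ⊗[k] A) (a : A) (c : C) {n m : ℕ} (x1 : Fin n → B)
    (x0 : Fin n → A) (r1 r2 : Fin m → C) (h : δA a = ∑ i, x1 i ⊗ₜ[k] x0 i)
    (h' : comul (R := k) c = ∑ j, r1 j ⊗ₜ[k] r2 j) :
    crossedCoaction δA (a ⊗ₜ[k] c)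
      = ∑ i, ∑ j, (x1 i ⊗ₜ[k] r2 j) ⊗ₜ[k] (x0 i ⊗ₜ[k] r1 j) := by
  simp [crossedCoaction, h, h', TensorProduct.sum_tmul, TensorProduct.tmul_sum]
  try exact Finset.sum_comm

theorem crossed_coassoc (δA : A →ₗ[k] B ⊗[k] A)
    (hδA1 : ∀ a : A, (TensorProduct.assoc k B B A)
        ((LinearMap.rTensor A (Coalgebra.comul (R := k))) (δA a))
        = (LinearMap.lTensor B δA) (δA a)) (x : A ⊗[k] C) :
    (TensorProduct.assoc k (B ⊗[k] C) (B ⊗[k] C) (A ⊗[k] C))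
        ((LinearMap.rTensor (A ⊗[k] C) (DrinComul k B C)) (crossedCoaction δA x))
        = (LinearMap.lTensor (B ⊗[k] C) (crossedCoaction δA)) (crossedCoaction δA x) := by
  induction x with
  | zero => simp
  | add x y hx hy => simp only [map_add, hx, hy]
  | tmul a c =>
    obtain ⟨n, x1, x0, h⟩ := exists_rep (δA a)
    obtain ⟨m, r1, r2, h'⟩ := exists_rep (comul (R := k) c)
    have e := hδA1 a
    have e' := coassoc_apply (R := k) c
    rw [crossed_sum δA a c x1 x0 r1 r2 h h']
    simp only [map_sum, LinearMap.rTensor_tmul, LinearMap.lTensor_tmul, drin_kap, crossed_kap]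
    simp only [h, map_sum, LinearMap.rTensor_tmul, LinearMap.lTensor_tmul] at e
    simp only [h', map_sum, LinearMap.rTensor_tmul, LinearMap.lTensor_tmul] at e'
    simp only [← map_sum, ← TensorProduct.tmul_sum, ← TensorProduct.sum_tmul] at e e' ⊢
    rw [e, e']

theorem crossed_counit (δA : A →ₗ[k] B ⊗[k] A)
    (hδA2 : ∀ a : A, (TensorProduct.lid k A)
        ((LinearMap.rTensor A (Coalgebra.counit (R := k))) (δA a)) = a) (x : A ⊗[k] C) :
    (TensorProduct.lid k (A ⊗[k] C))
        ((LinearMap.rTensor (A ⊗[k] C) (DrinCounit k B C)) (crossedCoaction δA x)) = x := by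
  induction x with
  | zero => simp
  | add x y hx hy => simp only [map_add, hx, hy]
  | tmul a c =>
    obtain ⟨n, x1, x0, h⟩ := exists_rep (δA a)
    obtain ⟨m, r1, r2, h'⟩ := exists_rep (comul (R := k) c)
    have e := hδA2 a
    have e' := congrArg (TensorProduct.rid k C) (lTensor_counit_comul (R := k) c)
    rw [crossed_sum δA a c x1 x0 r1 r2 h h']
    simp only [h, map_sum, LinearMap.rTensor_tmul, TensorProduct.lid_tmul] at e
    simp only [h', map_sum, LinearMap.lTensor_tmul, TensorProduct.rid_tmul, one_smul] at e'
    conv_rhs => rw [← e, ← e']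
    simp only [TensorProduct.sum_tmul, TensorProduct.tmul_sum, map_sum]
    rw [Finset.sum_comm]
    refine Finset.sum_congr rfl fun j _ => Finset.sum_congr rfl fun i _ => ?_
    simp only [DrinCounit, LinearMap.rTensor_tmul, LinearMap.comp_apply, TensorProduct.map_tmul,
      LinearMap.mul'_apply, TensorProduct.lid_tmul, TensorProduct.tmul_smul,
      ← TensorProduct.smul_tmul', smul_smul]
    rw [mul_comm]

/-- `(x ⊗ (y ⊗ z)) ⊗ (u ⊗ v) ↦ x ⊗ (y ⊗ (S(z) u ⊗ v))` in curried form -/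
def phi2 (k B A : Type) [Field k] [Ring B] [HopfAlgebra k B] [Ring A] [Algebra k A] :
    (B ⊗[k] B) ⊗[k] (B ⊗[k] A) →ₗ[k] B ⊗[k] (B ⊗[k] A) :=
  ((((LinearMap.mul' k B) ∘ₗ (HopfAlgebra.antipode k).rTensor B).rTensor A
      ∘ₗ (TensorProduct.assoc k B B A).symm.toLinearMap).lTensor B)
    ∘ₗ (TensorProduct.assoc k B B (B ⊗[k] A)).toLinearMap

@[simp] theorem phi2_tmul (y z u : B) (v : A) :
    phi2 k B A ((y ⊗ₜ[k] z) ⊗ₜ[k] (u ⊗ₜ[k] v))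
      = y ⊗ₜ[k] ((HopfAlgebra.antipode k z * u) ⊗ₜ[k] v) := by
  simp [phi2]

/-- `x ⊗ y ↦ x₍₁₎ ⊗ S(x₍₂₎) y⁽⁻¹⁾ ⊗ y⁽⁰⁾` -/
def Eh (δA : A →ₗ[k] B ⊗[k] A) : B ⊗[k] A →ₗ[k] B ⊗[k] (B ⊗[k] A) :=
  phi2 k B A ∘ₗ TensorProduct.map (comul (R := k)) δA

theorem Eh_delta (δA : A →ₗ[k] B ⊗[k] A)
    (hδA1 : ∀ a : A, (TensorProduct.assoc k B B A)
        ((LinearMap.rTensor A (Coalgebra.comul (R := k))) (δA a))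
        = (LinearMap.lTensor B δA) (δA a))
    (hδA2 : ∀ a : A, (TensorProduct.lid k A)
        ((LinearMap.rTensor A (Coalgebra.counit (R := k))) (δA a)) = a) (a : A) :
    Eh δA (δA a) = (TensorProduct.mk k B A 1).lTensor B (δA a) := by
  -- contraction `u ⊗ v ↦ S(u) v⁽⁻¹⁾ ⊗ v⁽⁰⁾`
  let Q0 : B ⊗[k] (B ⊗[k] A) →ₗ[k] B ⊗[k] A :=
    ((LinearMap.mul' k B) ∘ₗ (HopfAlgebra.antipode k).rTensor B).rTensor A
      ∘ₗ (TensorProduct.assoc k B B A).symm.toLinearMap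
  let Q : B ⊗[k] A →ₗ[k] B ⊗[k] A := Q0 ∘ₗ δA.lTensor B
  have hQ : ∀ y : A, Q (δA y) = 1 ⊗ₜ[k] y := by
    intro y
    have h1 : ∀ t : B ⊗[k] A, Q0 (TensorProduct.assoc k B B A
        ((LinearMap.rTensor A (Coalgebra.comul (R := k))) t))
        = 1 ⊗ₜ[k] (TensorProduct.lid k A)
        ((LinearMap.rTensor A (Coalgebra.counit (R := k))) t) := by
      intro t
      induction t with
      | zero => simp
      | add x y hx hy => simp only [map_add, hx, hy, TensorProduct.tmul_add]
      | tmul b x =>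
        simp [Q0, Algebra.algebraMap_eq_smul_one, TensorProduct.smul_tmul]
    have := h1 (δA y)
    rw [hδA1, hδA2] at this
    exact this
  have h2 : ∀ t : B ⊗[k] A, Eh δA t = Q.lTensor B (TensorProduct.assoc k B B A
        ((LinearMap.rTensor A (Coalgebra.comul (R := k))) t)) := by
    intro t
    induction t with
    | zero => simp
    | add x y hx hy => simp only [map_add, hx, hy]
    | tmul b x =>
      obtain ⟨n, f, g, h⟩ := exists_rep (comul (R := k) b)
      obtain ⟨n', f', g', h'⟩ := exists_rep (δA x)
      simp [Eh, Q, Q0, h, h', TensorProduct.sum_tmul, TensorProduct.tmul_sum]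
      exact Finset.sum_comm
  rw [h2, hδA1, ← LinearMap.lTensor_comp_apply]
  congr 2
  ext y
  simp [hQ]

/-- Cancellation identity used for the multiplicativity of the coaction. -/
theorem Eh_delta2 (δA : A →ₗ[k] B ⊗[k] A)
    (hδA1 : ∀ a : A, (TensorProduct.assoc k B B A)
        ((LinearMap.rTensor A (Coalgebra.comul (R := k))) (δA a))
        = (LinearMap.lTensor B δA) (δA a))
    (hδA2 : ∀ a : A, (TensorProduct.lid k A)
        ((LinearMap.rTensor A (Coalgebra.counit (R := k))) (δA a)) = a) (a : A) :
    (Eh δA).lTensor B (TensorProduct.assoc k B B A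
        ((LinearMap.rTensor A (Coalgebra.comul (R := k))) (δA a)))
      = ((TensorProduct.mk k B A 1).lTensor B ∘ₗ δA).lTensor B (δA a) := by
  rw [hδA1, ← LinearMap.lTensor_comp_apply]
  congr 2
  ext y
  simp [Eh_delta δA hδA1 hδA2]

/-- The product of the Drinfeld double as a function of the iterated coproduct. -/
def Dm (ev : C →ₗ[k] B →ₗ[k] k) (b : B) (c c' : C) : B ⊗[k] (B ⊗[k] B) →ₗ[k] B ⊗[k] C :=
  TensorProduct.map (LinearMap.mulLeft k b)
      (LinearMap.mulRight k c' ∘ₗ TensorProduct.lift (La ev)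
        ∘ₗ TensorProduct.map (HopfAlgebra.antipode k) ((Ra ev).flip c)
        ∘ₗ (TensorProduct.comm k B B).toLinearMap)
    ∘ₗ (TensorProduct.leftComm k B B B).toLinearMap

@[simp] theorem Dm_tmul (ev : C →ₗ[k] B →ₗ[k] k) (b : B) (c c' : C) (x y z : B) :
    Dm ev b c c' (x ⊗ₜ[k] (y ⊗ₜ[k] z))
      = (b * y) ⊗ₜ[k] (La ev (HopfAlgebra.antipode k z) (Ra ev x c) * c') := by
  simp [Dm]

theorem mD_eq {ev : C →ₗ[k] B →ₗ[k] k}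
    {mD : (B ⊗[k] C) ⊗[k] (B ⊗[k] C) →ₗ[k] B ⊗[k] C} (hmD : IsDrinMul ev mD)
    (b b' : B) (c c' : C) :
    mD ((b ⊗ₜ[k] c) ⊗ₜ[k] (b' ⊗ₜ[k] c'))
      = Dm ev b c c' ((comul (R := k)).lTensor B (comul (R := k) b')) := by
  obtain ⟨n, p1, p2, h⟩ := exists_rep (comul (R := k) b')
  choose q pp1 pp2 hp using fun i => exists_rep (comul (R := k) (p2 i))
  obtain ⟨m, r1, r2, h'⟩ := exists_rep (comul (R := k) c)
  choose s rr1 rr2 hr using fun i => exists_rep (comul (R := k) (r2 i))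
  rw [hmD b c b' c' n p1 p2 q pp1 pp2 m r1 r2 s rr1 rr2 h hp h' hr, h]
  simp only [map_sum, LinearMap.lTensor_tmul, hp, TensorProduct.tmul_sum, Dm_tmul]
  refine Finset.sum_congr rfl fun i _ => Finset.sum_congr rfl fun i' _ => ?_
  rw [← Ra_La, La_sum ev _ c r1 r2 h']
  simp only [map_sum, map_smul, Finset.sum_mul, TensorProduct.tmul_sum]
  refine Finset.sum_congr rfl fun j _ => ?_
  rw [Ra_sum ev _ (r2 j) (rr1 j) (rr2 j) (hr j)]
  simp only [Finset.smul_sum, Finset.sum_mul, TensorProduct.tmul_sum, smul_smul, smul_mul_assoc,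
    TensorProduct.tmul_smul]

/-- `x ⊗ (y ⊗ (z ⊗ v)) ↦ (α y ⊗ R x (L z q) q') ⊗ (β v ⊗ p p')`. -/
def Wm (ev : C →ₗ[k] B →ₗ[k] k) (α : B) (β : A) (p q p' q' : C) :
    B ⊗[k] (B ⊗[k] (B ⊗[k] A)) →ₗ[k] (B ⊗[k] C) ⊗[k] (A ⊗[k] C) :=
  ((TensorProduct.mk k A C).flip (p * p')).lTensor (B ⊗[k] C)
    ∘ₗ (TensorProduct.assoc k B C A).symm.toLinearMap
    ∘ₗ TensorProduct.map (LinearMap.mulLeft k α)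
        (TensorProduct.map (LinearMap.mulRight k q' ∘ₗ TensorProduct.lift (Ra ev)
          ∘ₗ ((La ev).flip q).lTensor B) (LinearMap.mulLeft k β)
        ∘ₗ (TensorProduct.assoc k B B A).symm.toLinearMap)
    ∘ₗ (TensorProduct.leftComm k B B (B ⊗[k] A)).toLinearMap

@[simp] theorem Wm_tmul (ev : C →ₗ[k] B →ₗ[k] k) (α : B) (β : A) (p q p' q' : C)
    (x y z : B) (v : A) :
    Wm ev α β p q p' q' (x ⊗ₜ[k] (y ⊗ₜ[k] (z ⊗ₜ[k] v)))
      = ((α * y) ⊗ₜ[k] (Ra ev x (La ev z q) * q')) ⊗ₜ[k] ((β * v) ⊗ₜ[k] (p * p')) := by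
  simp [Wm]

theorem key_pure {ev : C →ₗ[k] B →ₗ[k] k} (hev : IsWeakHopfPairing ev)
    (α : B) (β : A) (p' q' : C) (c : C) {m : ℕ} (p q : Fin m → C)
    (h : comul (R := k) c = ∑ j, p j ⊗ₜ[k] q j) (τ : B ⊗[k] (B ⊗[k] B)) (w : B ⊗[k] A) :
    ∑ j, Dm ev α (q j) q' τ ⊗ₜ[k] mu ev β (p j) p' w
      = ∑ j, Wm ev α β (p j) (q j) p' q' ((phi2 k B A).lTensor B
          (TensorProduct.assoc k B (B ⊗[k] B) (B ⊗[k] A) (τ ⊗ₜ[k] w))) := by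
  induction w with
  | zero => simp
  | add x y hx hy =>
    simp only [map_add, TensorProduct.tmul_add, Finset.sum_add_distrib, hx, hy]
  | tmul u v =>
    induction τ with
    | zero => simp
    | add x y hx hy =>
      simp only [map_add, TensorProduct.add_tmul, Finset.sum_add_distrib, hx, hy]
    | tmul x t =>
      induction t with
      | zero => simp
      | add x y hx hy =>
        simp only [map_add, TensorProduct.add_tmul, TensorProduct.tmul_add,
          Finset.sum_add_distrib, hx, hy]
      | tmul y z =>
        let G : C ⊗[k] C →ₗ[k] (B ⊗[k] C) ⊗[k] (A ⊗[k] C) :=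
          TensorProduct.map (TensorProduct.mk k B C (α * y) ∘ₗ LinearMap.mulRight k q' ∘ₗ
              La ev (HopfAlgebra.antipode k z) ∘ₗ Ra ev x)
            (TensorProduct.mk k A C (β * v) ∘ₗ LinearMap.mulRight k p')
          ∘ₗ (TensorProduct.comm k C C).toLinearMap
        have e := congrArg G (balance ev u c)
        rw [h] at e
        simpa [G, ← Ra_La, La_mul hev] using e

theorem key {ev : C →ₗ[k] B →ₗ[k] k} (hev : IsWeakHopfPairing ev) (δA : A →ₗ[k] B ⊗[k] A)
    (α : B) (β : A) (p' q' : C) (c : C) {m : ℕ} (p q : Fin m → C)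
    (h : comul (R := k) c = ∑ j, p j ⊗ₜ[k] q j) (b : B) (a0 : A) :
    ∑ j, Dm ev α (q j) q' ((comul (R := k)).lTensor B (comul (R := k) b))
        ⊗ₜ[k] mu ev β (p j) p' (δA a0)
      = ∑ j, Wm ev α β (p j) (q j) p' q' ((Eh δA).lTensor B
          (TensorProduct.assoc k B B A (comul (R := k) b ⊗ₜ[k] a0))) := by
  rw [key_pure hev α β p' q' c p q h]
  congr! 2
  generalize comul (R := k) b = s
  induction s with
  | zero => simp
  | add x y hx hy => simp only [map_add, TensorProduct.add_tmul, hx, hy]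
  | tmul x y => simp [Eh]

theorem crossed_mul_sum {ev : C →ₗ[k] B →ₗ[k] k} (hev : IsWeakHopfPairing ev)
    (δA : A →ₗ[k] B ⊗[k] A) (hδAalg : ∀ a a' : A, δA (a * a') = δA a * δA a')
    (a a0 : A) (b : B) (c c' : C) {n m m' : ℕ} (α : Fin n → B) (β : Fin n → A)
    (p q : Fin m → C) (p' q' : Fin m' → C)
    (h : δA a = ∑ l, α l ⊗ₜ[k] β l)
    (hc : comul (R := k) c = ∑ j, p j ⊗ₜ[k] q j)
    (hc' : comul (R := k) c' = ∑ j, p' j ⊗ₜ[k] q' j) :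
    crossedCoaction δA ((a * a0) ⊗ₜ[k] (Ra ev b c * c'))
      = ∑ l, ∑ j', ∑ j, Wm ev (α l) (β l) (p j) (q j) (p' j') (q' j')
          (b ⊗ₜ[k] (TensorProduct.mk k B A 1).lTensor B (δA a0)) := by
  simp only [crossedCoaction, LinearMap.comp_apply, TensorProduct.map_tmul, hδAalg,
    Bialgebra.comul_mul, comul_Ra, h, hc, hc']
  generalize δA a0 = w
  induction w with
  | zero => simp
  | add x y hx hy =>
    simp only [map_add, mul_add, TensorProduct.add_tmul, TensorProduct.tmul_add,
      Finset.sum_add_distrib, hx, hy]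
  | tmul u v =>
    simp only [map_sum, LinearMap.lTensor_tmul, Finset.sum_mul, Finset.mul_sum,
      Algebra.TensorProduct.tmul_mul_tmul, TensorProduct.sum_tmul, TensorProduct.tmul_sum,
      LinearEquiv.coe_coe, TensorProduct.comm_tmul, TensorProduct.tensorTensorTensorComm_tmul,
      TensorProduct.mk_apply, Wm_tmul, La_one hev]
    symm
    rw [Finset.sum_comm]
    refine Finset.sum_congr rfl fun j' _ => ?_
    rw [Finset.sum_comm]

end algebra

end CrossedAux

theorem crossed_product_is_drinfeld_comodule_algebra
    {A : Type} [Ring A] [Algebra k A]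
    (ev : C →ₗ[k] B →ₗ[k] k) (hev : IsWeakHopfPairing ev)
    (mD : (B ⊗[k] C) ⊗[k] (B ⊗[k] C) →ₗ[k] B ⊗[k] C) (hmD : IsDrinMul ev mD)
    -- `A` is a left `B`-comodule algebra
    (δA : A →ₗ[k] B ⊗[k] A)
    (hδA1 : ∀ a : A, (TensorProduct.assoc k B B A)
        ((LinearMap.rTensor A (Coalgebra.comul (R := k))) (δA a))
        = (LinearMap.lTensor B δA) (δA a))
    (hδA2 : ∀ a : A, (TensorProduct.lid k A)
        ((LinearMap.rTensor A (Coalgebra.counit (R := k))) (δA a)) = a)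
    (hδAalg : ∀ a a' : A, δA (a * a') = δA a * δA a')
    (hδAone : δA 1 = 1)
    -- `mAC` is the crossed product `(a⊗c)(a'⊗c') = a a'⁽⁰⁾ ⊗ c₍₁₎c' · ev(c₍₂₎, a'⁽⁻¹⁾)`
    (mAC : (A ⊗[k] C) ⊗[k] (A ⊗[k] C) →ₗ[k] A ⊗[k] C)
    (hmAC : ∀ (a : A) (c : C) (a' : A) (c' : C)
        (n : ℕ) (x1 : Fin n → B) (x0 : Fin n → A) (m : ℕ) (r1 r2 : Fin m → C),
      δA a' = ∑ i, x1 i ⊗ₜ[k] x0 i →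
      Coalgebra.comul (R := k) c = ∑ j, r1 j ⊗ₜ[k] r2 j →
      mAC ((a ⊗ₜ[k] c) ⊗ₜ[k] (a' ⊗ₜ[k] c'))
        = ∑ i, ∑ j, ev (r2 j) (x1 i) • ((a * x0 i) ⊗ₜ[k] (r1 j * c'))) :
    -- (i) the crossed product is an associative unital algebra
    (∀ x y z : A ⊗[k] C, mAC (mAC (x ⊗ₜ[k] y) ⊗ₜ[k] z) = mAC (x ⊗ₜ[k] mAC (y ⊗ₜ[k] z))) ∧
    (∀ x : A ⊗[k] C, mAC (((1 : A) ⊗ₜ[k] (1 : C)) ⊗ₜ[k] x) = x) ∧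
    (∀ x : A ⊗[k] C, mAC (x ⊗ₜ[k] ((1 : A) ⊗ₜ[k] (1 : C))) = x) ∧
    -- (ii) `δ` is a left `Drin_k(C,B)`-comodule structure
    (∀ x : A ⊗[k] C, (TensorProduct.assoc k (B ⊗[k] C) (B ⊗[k] C) (A ⊗[k] C))
        ((LinearMap.rTensor (A ⊗[k] C) (DrinComul k B C)) (crossedCoaction δA x))
        = (LinearMap.lTensor (B ⊗[k] C) (crossedCoaction δA)) (crossedCoaction δA x)) ∧
    (∀ x : A ⊗[k] C, (TensorProduct.lid k (A ⊗[k] C))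
        ((LinearMap.rTensor (A ⊗[k] C) (DrinCounit k B C)) (crossedCoaction δA x)) = x) ∧
    -- (iii) `δ` is an algebra homomorphism into `Drin_k(C,B) ⊗ (A ⋊ C^cop)`
    (∀ x y : A ⊗[k] C,
      crossedCoaction δA (mAC (x ⊗ₜ[k] y))
        = (TensorProduct.map mD mAC)
            ((TensorProduct.tensorTensorTensorComm k (B ⊗[k] C) (A ⊗[k] C)
                (B ⊗[k] C) (A ⊗[k] C))
              (crossedCoaction δA x ⊗ₜ[k] crossedCoaction δA y))) ∧
    (crossedCoaction δA ((1 : A) ⊗ₜ[k] (1 : C))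
        = ((1 : B) ⊗ₜ[k] (1 : C)) ⊗ₜ[k] ((1 : A) ⊗ₜ[k] (1 : C))) := by


  have hm : ∀ (a : A) (c : C) (a' : A) (c' : C),
      mAC ((a ⊗ₜ[k] c) ⊗ₜ[k] (a' ⊗ₜ[k] c')) = CrossedAux.mu ev a c c' (δA a') := by
    intro a c a' c'
    obtain ⟨n, x1, x0, h⟩ := CrossedAux.exists_rep (δA a')
    obtain ⟨m, r1, r2, h'⟩ := CrossedAux.exists_rep (Coalgebra.comul (R := k) c)
    rw [hmAC a c a' c' n x1 x0 m r1 r2 h h', h]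
    simp only [map_sum, CrossedAux.mu_tmul, CrossedAux.Ra_sum ev _ c r1 r2 h', Finset.sum_mul,
      TensorProduct.tmul_sum, smul_mul_assoc, TensorProduct.tmul_smul]
  refine ⟨?_, ?_, ?_, CrossedAux.crossed_coassoc δA hδA1, CrossedAux.crossed_counit δA hδA2,
    ?_, ?_⟩
  · intro x y z
    induction x with
    | zero => simp
    | add x y hx hy => simp only [map_add, TensorProduct.add_tmul, hx, hy]
    | tmul a c =>
    induction y with
    | zero => simp
    | add x y hx hy => simp only [map_add, TensorProduct.add_tmul, TensorProduct.tmul_add, hx, hy]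
    | tmul a' c' =>
    induction z with
    | zero => simp
    | add x y hx hy => simp only [map_add, TensorProduct.tmul_add, hx, hy]
    | tmul a'' c'' =>
    obtain ⟨n, b, a0, h⟩ := CrossedAux.exists_rep (δA a')
    obtain ⟨n', x, y, h'⟩ := CrossedAux.exists_rep (δA a'')
    rw [hm, hm, h]
    simp only [map_sum, CrossedAux.mu_tmul, TensorProduct.sum_tmul, hm, CrossedAux.mu_mul hev,
      hδA1]
    rw [h']
    simp only [map_sum, LinearMap.lTensor_tmul, CrossedAux.mu_tmul, TensorProduct.tmul_sum, hm,
      hδAalg, h, Finset.sum_mul, CrossedAux.mu_tmul_mul hev]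
    exact Finset.sum_comm
  · intro x
    induction x with
    | zero => simp
    | add x y hx hy => simp only [map_add, TensorProduct.tmul_add, hx, hy]
    | tmul a c =>
      have e := hδA2 a
      obtain ⟨n, b, a0, h⟩ := CrossedAux.exists_rep (δA a)
      rw [hm, h]
      rw [h] at e
      simp only [map_sum, LinearMap.rTensor_tmul, TensorProduct.lid_tmul] at e
      conv_rhs => rw [← e]
      simp [CrossedAux.Ra_one' hev, TensorProduct.sum_tmul, TensorProduct.smul_tmul]
  · intro x
    induction x with
    | zero => simp
    | add x y hx hy => simp only [map_add, TensorProduct.add_tmul, hx, hy]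
    | tmul a c =>
      rw [hm, hδAone, Algebra.TensorProduct.one_def, CrossedAux.mu_tmul, CrossedAux.Ra_one hev]
      simp
  · intro x y
    induction x with
    | zero => simp only [TensorProduct.zero_tmul, TensorProduct.tmul_zero,
        LinearMap.map_zero, LinearEquiv.map_zero]
    | add x y hx hy => simp only [map_add, TensorProduct.add_tmul, hx, hy]
    | tmul a c =>
    induction y with
    | zero => simp only [TensorProduct.zero_tmul, TensorProduct.tmul_zero,
        LinearMap.map_zero, LinearEquiv.map_zero]
    | add x y hx hy => simp only [map_add, TensorProduct.tmul_add, hx, hy]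
    | tmul a' c' =>
    have e := CrossedAux.Eh_delta2 δA hδA1 hδA2 a'
    obtain ⟨n, α, β, h⟩ := CrossedAux.exists_rep (δA a)
    obtain ⟨n', b, a0, h'⟩ := CrossedAux.exists_rep (δA a')
    obtain ⟨m, p, q, hc⟩ := CrossedAux.exists_rep (Coalgebra.comul (R := k) c)
    obtain ⟨m', p', q', hc'⟩ := CrossedAux.exists_rep (Coalgebra.comul (R := k) c')
    rw [h'] at e
    simp only [map_sum, LinearMap.rTensor_tmul, LinearMap.lTensor_tmul,
      LinearMap.comp_apply] at e
    rw [hm, h', CrossedAux.crossed_sum δA a c α β p q h hc,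
      CrossedAux.crossed_sum δA a' c' b a0 p' q' h' hc']
    simp only [map_sum, CrossedAux.mu_tmul,
      CrossedAux.crossed_mul_sum hev δA hδAalg a _ _ c c' α β p q p' q' h hc hc']
    have lhs : ∀ (f : Fin n' → Fin n → Fin m' → Fin m → (B ⊗[k] C) ⊗[k] (A ⊗[k] C)),
        ∑ i, ∑ l, ∑ j', ∑ j, f i l j' j = ∑ l, ∑ j', ∑ j, ∑ i, f i l j' j := by
      intro f
      rw [Finset.sum_comm]
      refine Finset.sum_congr rfl fun l _ => ?_
      rw [Finset.sum_comm]
      refine Finset.sum_congr rfl fun j' _ => ?_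
      rw [Finset.sum_comm]
    rw [lhs]
    simp only [← map_sum, ← e]
    simp only [map_sum]
    simp only [TensorProduct.sum_tmul, TensorProduct.tmul_sum, map_sum,
      TensorProduct.tensorTensorTensorComm_tmul, TensorProduct.map_tmul, hm,
      CrossedAux.mD_eq hmD]
    simp only [CrossedAux.key hev δA _ _ _ _ c p q hc]
    rw [← lhs]
    refine Finset.sum_congr rfl fun i _ => ?_
    rw [Finset.sum_comm]
  · simp [crossedCoaction, hδAone, Algebra.TensorProduct.one_def]

end
end

section
/- Let C and B be weakly dual Hopf algebras over a field k with pairing ev. Define γ: Drin_k(C,B)⊗Drin_k(C,B) → k by γ((b⊗c)⊗(b'⊗c')) := ε(b) ε(c') ev(c, b') (the 2-cocycle induced by the trivial 2-cocycles on B and C). Then the right twist of the Drinfeld double product by γ equals the Heisenberg double product: (b⊗c)₍₁₎(b'⊗c')₍₁₎ · γ((b⊗c)₍₂₎ ⊗ (b'⊗c')₍₂₎) = b b'₍₂₎ ⊗ c₍₁₎c' · ev(c₍₂₎, b'₍₁₎), where Sweedler components are taken with respect to the coproduct of Drin_k(C,B) and the product on the left-hand side is that of Drin_k(C,B). Hence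 the Heisenberg double Heis_k(C,B), defined on B⊗C by the product (b⊗c)(b'⊗c') = b b'₍₂₎ ⊗ c₍₁₎c' ev(c₍₂₎, b'₍₁₎), is a right 2-cocycle twist of Drin_k(C,B). -/
/-!
STATEMENT 18: For weakly dual Hopf algebras `C`, `B`, the 2-cocycle
`γ((b⊗c)⊗(b'⊗c')) = ε(b) ε(c') ev(c, b')` induced by the trivial 2-cocycles twists the
Drinfeld double product into the Heisenberg double product
`(b⊗c)(b'⊗c') = b b'₍₂₎ ⊗ c₍₁₎c' ev(c₍₂₎, b'₍₁₎)`.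
-/

open scoped TensorProduct

noncomputable section

variable {k B C : Type} [Field k] [Ring B] [HopfAlgebra k B] [Ring C] [HopfAlgebra k C]

/-- left action `z, c ↦ ev(c₁, z) c₂` -/
def actL (ev : C →ₗ[k] B →ₗ[k] k) : B →ₗ[k] C →ₗ[k] C :=
  LinearMap.mk₂ k (fun z c => TensorProduct.lid k C ((ev.flip z).rTensor C (Coalgebra.comul (R := k) c)))
    (by intros; simp [LinearMap.rTensor_add]) (by intros; simp [LinearMap.rTensor_smul])
    (by intros; simp) (by intros; simp)

/-- right action `z, c ↦ c₁ ev(c₂, z)` -/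
def actR (ev : C →ₗ[k] B →ₗ[k] k) : B →ₗ[k] C →ₗ[k] C :=
  LinearMap.mk₂ k (fun z c => TensorProduct.rid k C ((ev.flip z).lTensor C (Coalgebra.comul (R := k) c)))
    (by intros; simp [LinearMap.lTensor_add]) (by intros; simp [LinearMap.lTensor_smul])
    (by intros; simp) (by intros; simp)

theorem actL_sum (ev : C →ₗ[k] B →ₗ[k] k) (z : B) (c : C) (n : ℕ) (r1 r2 : Fin n → C)
    (h : Coalgebra.comul (R := k) c = ∑ j, r1 j ⊗ₜ[k] r2 j) :
    actL ev z c = ∑ j, ev (r1 j) z • r2 j := by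
  simp [actL, h]

theorem actR_sum (ev : C →ₗ[k] B →ₗ[k] k) (z : B) (c : C) (n : ℕ) (r1 r2 : Fin n → C)
    (h : Coalgebra.comul (R := k) c = ∑ j, r1 j ⊗ₜ[k] r2 j) :
    actR ev z c = ∑ j, ev (r2 j) z • r1 j := by
  simp [actR, h]

theorem exists_fin_repr {M N : Type} [AddCommGroup M] [Module k M] [AddCommGroup N] [Module k N]
    (t : M ⊗[k] N) : ∃ (n : ℕ) (x : Fin n → M) (y : Fin n → N), t = ∑ i, x i ⊗ₜ[k] y i := by
  induction t using TensorProduct.induction_on with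
  | zero => exact ⟨0, Fin.elim0, Fin.elim0, by simp⟩
  | tmul x y => exact ⟨1, fun _ => x, fun _ => y, by simp⟩
  | add a b ha hb =>
    obtain ⟨n, x, y, rfl⟩ := ha
    obtain ⟨m, x', y', rfl⟩ := hb
    exact ⟨n + m, Fin.append x x', Fin.append y y', by simp [Fin.sum_univ_add]⟩

theorem ev_mul_eq (ev : C →ₗ[k] B →ₗ[k] k) (hev : IsWeakHopfPairing ev) (b b' : B) :
    ev.flip (b * b') = LinearMap.mul' k k ∘ₗ TensorProduct.map (ev.flip b') (ev.flip b)
      ∘ₗ Coalgebra.comul (R := k) := by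
  ext c
  obtain ⟨n, c1, c2, h⟩ := exists_fin_repr (Coalgebra.comul (R := k) c)
  simp [h, hev.2.1 c b b' n c1 c2 h]

theorem actL_actL (ev : C →ₗ[k] B →ₗ[k] k) (hev : IsWeakHopfPairing ev) (b b' : B) (c : C) :
    actL ev b (actL ev b' c) = actL ev (b * b') c := by
  have key : ∀ t : C ⊗[k] C,
      actL ev b (TensorProduct.lid k C ((ev.flip b').rTensor C t)) =
      TensorProduct.lid k C ((LinearMap.mul' k k).rTensor C
        ((TensorProduct.map (ev.flip b') (ev.flip b)).rTensor C
        ((TensorProduct.assoc k C C C).symm ((Coalgebra.comul (R := k)).lTensor C t)))) := by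
    intro t
    induction t using TensorProduct.induction_on with
    | zero => simp
    | add x y hx hy => simp only [map_add, hx, hy]
    | tmul x y =>
      obtain ⟨n, c1, c2, h⟩ := exists_fin_repr (Coalgebra.comul (R := k) y)
      simp [actL, h, TensorProduct.tmul_sum, Finset.smul_sum, mul_smul]
  have h1 := key (Coalgebra.comul (R := k) c)
  rw [Coalgebra.coassoc_symm_apply] at h1
  refine h1.trans ?_
  simp only [actL, LinearMap.mk₂_apply, ev_mul_eq ev hev, LinearMap.rTensor_comp,
    LinearMap.comp_apply]

theorem actL_one (ev : C →ₗ[k] B →ₗ[k] k) (hev : IsWeakHopfPairing ev) (c : C) :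
    actL ev 1 c = c := by
  have : ev.flip 1 = Coalgebra.counit (R := k) := by ext x; simp [hev.2.2.2.1]
  simp [actL, this]

theorem drin_formula (ev : C →ₗ[k] B →ₗ[k] k)
    (mD : (B ⊗[k] C) ⊗[k] (B ⊗[k] C) →ₗ[k] B ⊗[k] C) (hmD : IsDrinMul ev mD)
    (b : B) (c : C) (b' : B) (c' : C)
    (n : ℕ) (p1 p2 : Fin n → B) (q : Fin n → ℕ) (pp1 pp2 : (i : Fin n) → Fin (q i) → B)
    (h : Coalgebra.comul (R := k) b' = ∑ i, p1 i ⊗ₜ[k] p2 i)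
    (h2 : ∀ i, Coalgebra.comul (R := k) (p2 i) = ∑ i', pp1 i i' ⊗ₜ[k] pp2 i i') :
    mD ((b ⊗ₜ[k] c) ⊗ₜ[k] (b' ⊗ₜ[k] c')) = ∑ i, ∑ i',
      (b * pp1 i i') ⊗ₜ[k]
        (actR ev (p1 i) (actL ev (HopfAlgebra.antipode (R := k) (pp2 i i')) c) * c') := by
  obtain ⟨m, r1, r2, hr⟩ := exists_fin_repr (Coalgebra.comul (R := k) c)
  choose s rr1 rr2 hrr using fun j => exists_fin_repr (Coalgebra.comul (R := k) (r2 j))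
  rw [hmD b c b' c' n p1 p2 q pp1 pp2 m r1 r2 s rr1 rr2 h h2 hr hrr]
  refine Finset.sum_congr rfl fun i _ => Finset.sum_congr rfl fun i' _ => ?_
  rw [actL_sum ev _ c m r1 r2 hr, map_sum, Finset.sum_mul, TensorProduct.tmul_sum]
  refine Finset.sum_congr rfl fun j _ => ?_
  rw [map_smul, actR_sum ev _ (r2 j) _ _ _ (hrr j), Finset.smul_sum, Finset.sum_mul,
    TensorProduct.tmul_sum]
  refine Finset.sum_congr rfl fun j' _ => ?_
  rw [smul_smul, smul_mul_assoc, TensorProduct.tmul_smul]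

/-- `x ⊗ (y ⊗ z) ↦ b y ⊗ R_x (L_z c) c'` -/
def bigT (ev : C →ₗ[k] B →ₗ[k] k) (b : B) (c c' : C) : B ⊗[k] (B ⊗[k] B) →ₗ[k] B ⊗[k] C :=
  TensorProduct.lift (LinearMap.mk₂ k
    (fun x t => TensorProduct.map (LinearMap.mulLeft k b)
      (LinearMap.mulRight k c' ∘ₗ actR ev x ∘ₗ (actL ev).flip c) t)
    (by intros; simp [LinearMap.add_comp, LinearMap.comp_add, TensorProduct.map_add_right])
    (by intros; simp [LinearMap.smul_comp, LinearMap.comp_smul, TensorProduct.map_smul_right])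
    (by intros; simp) (by intros; simp))

theorem bigT_tmul (ev : C →ₗ[k] B →ₗ[k] k) (b : B) (c c' : C) (x y z : B) :
    bigT ev b c c' (x ⊗ₜ[k] (y ⊗ₜ[k] z)) = (b * y) ⊗ₜ[k] (actR ev x (actL ev z c) * c') := by
  simp [bigT]

/-- `(y ⊗ z) ⊗ w ↦ y ⊗ S(z) w` -/
def antiMap (k B : Type) [Field k] [Ring B] [HopfAlgebra k B] :
    (B ⊗[k] B) ⊗[k] B →ₗ[k] B ⊗[k] B :=
  (LinearMap.mul' k B ∘ₗ (HopfAlgebra.antipode k).rTensor B).lTensor B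
    ∘ₗ (TensorProduct.assoc k B B B).toLinearMap

theorem antiMap_comul (x : B) :
    antiMap k B ((Coalgebra.comul (R := k)).rTensor B (Coalgebra.comul (R := k) x)) =
      x ⊗ₜ[k] 1 := by
  simp only [antiMap, LinearMap.comp_apply, LinearEquiv.coe_coe, Coalgebra.coassoc_apply]
  rw [← LinearMap.comp_apply, ← LinearMap.lTensor_comp, LinearMap.comp_assoc,
    HopfAlgebra.mul_antipode_rTensor_comul, LinearMap.lTensor_comp, LinearMap.comp_apply,
    Coalgebra.lTensor_counit_comul]
  simp

theorem four_sum (T : B ⊗[k] (B ⊗[k] B) →ₗ[k] B ⊗[k] C) (b' : B)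
    (n : ℕ) (p1 p2 : Fin n → B)
    (h : Coalgebra.comul (R := k) b' = ∑ i, p1 i ⊗ₜ[k] p2 i)
    (a : Fin n → ℕ) (u1 u2 : (i : Fin n) → Fin (a i) → B)
    (hu : ∀ i, Coalgebra.comul (R := k) (p1 i) = ∑ l, u1 i l ⊗ₜ[k] u2 i l)
    (q : (i : Fin n) → Fin (a i) → ℕ) (v1 v2 : (i : Fin n) → (l : Fin (a i)) → Fin (q i l) → B)
    (hv : ∀ i l, Coalgebra.comul (R := k) (u2 i l) = ∑ o, v1 i l o ⊗ₜ[k] v2 i l o) :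
    ∑ i, ∑ l, ∑ o, T (u1 i l ⊗ₜ[k] (v1 i l o ⊗ₜ[k]
      (HopfAlgebra.antipode k (v2 i l o) * p2 i))) = ∑ i, T (p1 i ⊗ₜ[k] (p2 i ⊗ₜ[k] 1)) := by
  have h1 : ∑ i, ∑ l, ∑ o, T (u1 i l ⊗ₜ[k] (v1 i l o ⊗ₜ[k]
      (HopfAlgebra.antipode k (v2 i l o) * p2 i))) =
      T ((antiMap k B ∘ₗ (Coalgebra.comul (R := k)).rTensor B).lTensor B
        (TensorProduct.assoc k B B B
          ((Coalgebra.comul (R := k)).rTensor B (Coalgebra.comul (R := k) b')))) := by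
    rw [h]
    simp [hu, hv, TensorProduct.sum_tmul, TensorProduct.tmul_sum, antiMap]
  rw [h1, Coalgebra.coassoc_apply, h]
  simp [antiMap_comul]

theorem twist_left (ev : C →ₗ[k] B →ₗ[k] k)
    (mD : (B ⊗[k] C) ⊗[k] (B ⊗[k] C) →ₗ[k] B ⊗[k] C)
    (γ : (B ⊗[k] C) ⊗[k] (B ⊗[k] C) →ₗ[k] k)
    (hγ : ∀ (b : B) (c : C) (b' : B) (c' : C),
      γ ((b ⊗ₜ[k] c) ⊗ₜ[k] (b' ⊗ₜ[k] c'))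
        = Coalgebra.counit (R := k) b * Coalgebra.counit (R := k) c' * ev c b')
    (b : B) (c : C) (b' : B) (c' : C) (n : ℕ) (p1 p2 : Fin n → B)
    (h : Coalgebra.comul (R := k) b' = ∑ i, p1 i ⊗ₜ[k] p2 i) :
    TensorProduct.rid k (B ⊗[k] C) (TensorProduct.map mD γ
      (TensorProduct.tensorTensorTensorComm k _ _ _ _
        (DrinComul k B C (b ⊗ₜ[k] c) ⊗ₜ[k] DrinComul k B C (b' ⊗ₜ[k] c')))) =
    ∑ i, mD ((b ⊗ₜ[k] actL ev (p2 i) c) ⊗ₜ[k] (p1 i ⊗ₜ[k] c')) := by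
  obtain ⟨m, r1, r2, hr⟩ := exists_fin_repr (Coalgebra.comul (R := k) c)
  obtain ⟨s, t1, t2, ht⟩ := exists_fin_repr (Coalgebra.comul (R := k) c')
  obtain ⟨w, d1, d2, hd⟩ := exists_fin_repr (Coalgebra.comul (R := k) b)
  have hb : b = ∑ i, Coalgebra.counit (R := k) (d2 i) • d1 i := by
    have := congrArg (TensorProduct.rid k B) (Coalgebra.lTensor_counit_comul (R := k) b)
    rw [hd] at this
    simpa using this.symm
  have hc : c' = ∑ i, Coalgebra.counit (R := k) (t1 i) • t2 i := by
    have := congrArg (TensorProduct.lid k C) (Coalgebra.rTensor_counit_comul (R := k) c')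
    rw [ht] at this
    simpa using this.symm
  have hL : DrinComul k B C (b ⊗ₜ[k] c) =
      ∑ i, ∑ j, (d1 i ⊗ₜ[k] r2 j) ⊗ₜ[k] (d2 i ⊗ₜ[k] r1 j) := by
    simp [DrinComul, hd, hr, TensorProduct.sum_tmul, TensorProduct.tmul_sum]
    exact Finset.sum_comm
  have hR : DrinComul k B C (b' ⊗ₜ[k] c') =
      ∑ i, ∑ j, (p1 i ⊗ₜ[k] t2 j) ⊗ₜ[k] (p2 i ⊗ₜ[k] t1 j) := by
    simp [DrinComul, h, ht, TensorProduct.sum_tmul, TensorProduct.tmul_sum]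
    exact Finset.sum_comm
  rw [hL, hR]
  have hA : ∀ i, actL ev (p2 i) c = ∑ j, ev (r1 j) (p2 i) • r2 j :=
    fun i => actL_sum ev _ c m r1 r2 hr
  simp only [hA]
  have e1 : ∀ i, mD ((b ⊗ₜ[k] ∑ j, ev (r1 j) (p2 i) • r2 j) ⊗ₜ[k] (p1 i ⊗ₜ[k] c')) =
     ∑ y, ∑ x, ∑ j, (Coalgebra.counit (R := k) (d2 x) * Coalgebra.counit (R := k) (t1 y) *
        ev (r1 j) (p2 i)) • mD ((d1 x ⊗ₜ[k] r2 j) ⊗ₜ[k] (p1 i ⊗ₜ[k] t2 y)) := by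
    intro i
    conv_lhs => rw [hb, hc]
    simp only [TensorProduct.sum_tmul, TensorProduct.tmul_sum, map_sum]
    simp only [← TensorProduct.smul_tmul', TensorProduct.tmul_smul, map_smul, smul_smul]
    refine Finset.sum_congr rfl fun y _ => ?_
    rw [Finset.sum_comm]
    refine Finset.sum_congr rfl fun x _ => Finset.sum_congr rfl fun j _ => ?_
    congr 1
    ring
  simp only [e1]
  simp only [TensorProduct.sum_tmul, TensorProduct.tmul_sum, map_sum,
    TensorProduct.tensorTensorTensorComm_tmul, TensorProduct.map_tmul, TensorProduct.rid_tmul, hγ]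

theorem heisenberg_double_is_twist_of_drinfeld_double
    (ev : C →ₗ[k] B →ₗ[k] k) (hev : IsWeakHopfPairing ev)
    (mD : (B ⊗[k] C) ⊗[k] (B ⊗[k] C) →ₗ[k] B ⊗[k] C) (hmD : IsDrinMul ev mD)
    -- `γ` is the 2-cocycle induced by the trivial 2-cocycles on `B` and `C`
    (γ : (B ⊗[k] C) ⊗[k] (B ⊗[k] C) →ₗ[k] k)
    (hγ : ∀ (b : B) (c : C) (b' : B) (c' : C),
      γ ((b ⊗ₜ[k] c) ⊗ₜ[k] (b' ⊗ₜ[k] c'))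
        = Coalgebra.counit (R := k) b * Coalgebra.counit (R := k) c' * ev c b') :
    -- the right twist of the Drinfeld double product by `γ` is the Heisenberg product
    ∀ (b : B) (c : C) (b' : B) (c' : C)
      (nx mx : ℕ) (x1 x2 : Fin nx → B ⊗[k] C) (y1 y2 : Fin mx → B ⊗[k] C)
      (n : ℕ) (p1 p2 : Fin n → B) (m : ℕ) (r1 r2 : Fin m → C),
      DrinComul k B C (b ⊗ₜ[k] c) = ∑ i, x1 i ⊗ₜ[k] x2 i →
      DrinComul k B C (b' ⊗ₜ[k] c') = ∑ j, y1 j ⊗ₜ[k] y2 j →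
      Coalgebra.comul (R := k) b' = ∑ i, p1 i ⊗ₜ[k] p2 i →
      Coalgebra.comul (R := k) c = ∑ j, r1 j ⊗ₜ[k] r2 j →
      ∑ i, ∑ j, γ (x2 i ⊗ₜ[k] y2 j) • mD (x1 i ⊗ₜ[k] y1 j)
        = ∑ i, ∑ j, ev (r2 j) (p1 i) • ((b * p2 i) ⊗ₜ[k] (r1 j * c')) := by
  intro b c b' c' nx mx x1 x2 y1 y2 n p1 p2 m r1 r2 hx hy hp hr
  have h0 := twist_left ev mD γ hγ b c b' c' n p1 p2 hp
  rw [hx, hy] at h0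
  have h1 : ∑ i, ∑ j, γ (x2 i ⊗ₜ[k] y2 j) • mD (x1 i ⊗ₜ[k] y1 j) =
      TensorProduct.rid k (B ⊗[k] C) (TensorProduct.map mD γ
      (TensorProduct.tensorTensorTensorComm k _ _ _ _
        ((∑ i, x1 i ⊗ₜ[k] x2 i) ⊗ₜ[k] (∑ j, y1 j ⊗ₜ[k] y2 j)))) := by
    simp only [TensorProduct.sum_tmul, TensorProduct.tmul_sum, map_sum,
      TensorProduct.tensorTensorTensorComm_tmul, TensorProduct.map_tmul, TensorProduct.rid_tmul]
    try exact Finset.sum_comm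
  rw [h1, h0]
  choose a u1 u2 hu using fun i => exists_fin_repr (Coalgebra.comul (R := k) (p1 i))
  choose q v1 v2 hv using fun i l => exists_fin_repr (Coalgebra.comul (R := k) (u2 i l))
  have h2 := four_sum (bigT ev b c c') b' n p1 p2 hp a u1 u2 hu q v1 v2 hv
  simp only [bigT_tmul, actL_one ev hev, ← actL_actL ev hev] at h2
  refine Eq.trans (Finset.sum_congr rfl fun i _ => ?_) (h2.trans ?_)
  · exact drin_formula ev mD hmD b _ (p1 i) c' (a i) (u1 i) (u2 i) (q i) (v1 i) (v2 i)
      (hu i) (hv i)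
  · refine Finset.sum_congr rfl fun i _ => ?_
    rw [actR_sum ev _ c m r1 r2 hr, Finset.sum_mul, TensorProduct.tmul_sum]
    simp only [smul_mul_assoc, TensorProduct.tmul_smul]

end
end
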